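/- Let 1 ≤ p < ∞, 0 < α ≤ 1, and let B* ⊂ ℝⁿ be a ball. Assume φ : ℝⁿ × (0,∞) → (0,∞) satisfies φ(x,r) = r^α for all balls B(x,r) ⊂ B*. Then every f with ‖f‖_{𝓛_{p,φ}} < ∞ coincides almost everywhere on B* with a continuous function, and there is a constant C depending only on n and α such that |f(x) − f(y)| ≤ C|x − y|^α ‖f‖_{𝓛_{p,φ}} for (the continuous representative of) f and all x, y ∈ B*, i.e. ‖f‖_{Lip_α(B*)} ≤ C‖f‖_{𝓛_{p,φ}}. Moreover, if B* = B(0,1), then additionally |f(0) − f_{B(0,1)}| ≤ C‖f‖_{𝓛_{p,φ}}, so that ‖f‖_{𝓛_{p,φ}} + |f_{B(0,1)}| and ‖f‖_{𝓛_{p,φ}} + |f(0)| are equivalent. -/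

import Mathlib

open MeasureTheory Metric Filter
open scoped ENNReal NNReal

noncomputable section

/-- Average of `f` over the ball `B(x,r)`. -/
def ballAvg {n : ℕ} (f : EuclideanSpace ℝ (Fin n) → ℝ) (x : EuclideanSpace ℝ (Fin n))
    (r : ℝ) : ℝ :=
  (volume (ball x r)).toReal⁻¹ * ∫ y in ball x r, f y

/-- Campanato seminorm with variable growth function `φ`. -/
def campSemi {n : ℕ} (p : ℝ) (φ : EuclideanSpace ℝ (Fin n) → ℝ → ℝ)
    (f : EuclideanSpace ℝ (Fin n) → ℝ) : ℝ≥0∞ :=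
  ⨆ (x : EuclideanSpace ℝ (Fin n)) (r : ℝ) (_ : 0 < r),
    ENNReal.ofReal ((φ x r)⁻¹ *
      ((volume (ball x r)).toReal⁻¹ * ∫ y in ball x r, |f y - ballAvg f x r| ^ p) ^ (1 / p))

/-- Campanato norm: seminorm plus `|f_{B(0,1)}|`. -/
def campNorm {n : ℕ} (p : ℝ) (φ : EuclideanSpace ℝ (Fin n) → ℝ → ℝ)
    (f : EuclideanSpace ℝ (Fin n) → ℝ) : ℝ≥0∞ :=
  campSemi p φ f + ENNReal.ofReal |ballAvg f 0 1|

/-- Morrey norm with variable growth function `φ`. -/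
def morreyNorm {n : ℕ} (p : ℝ) (φ : EuclideanSpace ℝ (Fin n) → ℝ → ℝ)
    (f : EuclideanSpace ℝ (Fin n) → ℝ) : ℝ≥0∞ :=
  ⨆ (x : EuclideanSpace ℝ (Fin n)) (r : ℝ) (_ : 0 < r),
    ENNReal.ofReal ((φ x r)⁻¹ *
      ((volume (ball x r)).toReal⁻¹ * ∫ y in ball x r, |f y| ^ p) ^ (1 / p))

/-- Hölder seminorm with variable growth function `φ`. -/
def holderSemi {n : ℕ} (φ : EuclideanSpace ℝ (Fin n) → ℝ → ℝ)
    (f : EuclideanSpace ℝ (Fin n) → ℝ) : ℝ≥0∞ :=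
  ⨆ (x : EuclideanSpace ℝ (Fin n)) (y : EuclideanSpace ℝ (Fin n)) (_ : x ≠ y),
    ENNReal.ofReal (2 * |f x - f y| / (φ x (dist x y) + φ y (dist x y)))

/-- The doubling condition (D) with constant `A`. -/
def DoublingWith {n : ℕ} (A : ℝ) (φ : EuclideanSpace ℝ (Fin n) → ℝ → ℝ) : Prop :=
  ∀ (x : EuclideanSpace ℝ (Fin n)) (r s : ℝ), 0 < r → 0 < s →
    1 / 2 ≤ s / r → s / r ≤ 2 → A⁻¹ ≤ φ x s / φ x r ∧ φ x s / φ x r ≤ A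

/-- The doubling condition (D). -/
def Doubling {n : ℕ} (φ : EuclideanSpace ℝ (Fin n) → ℝ → ℝ) : Prop :=
  ∃ A > 0, DoublingWith A φ

/-- The nearness condition (N). -/
def Nearness {n : ℕ} (φ : EuclideanSpace ℝ (Fin n) → ℝ → ℝ) : Prop :=
  ∃ A > 0, ∀ (x y : EuclideanSpace ℝ (Fin n)) (r : ℝ), 0 < r → dist x y ≤ r →
    A⁻¹ ≤ φ x r / φ y r ∧ φ x r / φ y r ≤ A

/-- The almost increasing condition (I). -/
def AlmostIncreasing {n : ℕ} (φ : EuclideanSpace ℝ (Fin n) → ℝ → ℝ) : Prop :=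
  ∃ A > 0, ∀ (x : EuclideanSpace ℝ (Fin n)) (r s : ℝ), 0 < r → r < s → φ x r ≤ A * φ x s

/-- Positivity of the variable growth function. -/
def GrowthPos {n : ℕ} (φ : EuclideanSpace ℝ (Fin n) → ℝ → ℝ) : Prop :=
  ∀ (x : EuclideanSpace ℝ (Fin n)) (r : ℝ), 0 < r → 0 < φ x r

/-- `f ∈ L^p_loc(ℝⁿ)` (in particular `f ∈ L¹_loc`). -/
def MemLpLoc {n : ℕ} (p : ℝ) (f : EuclideanSpace ℝ (Fin n) → ℝ) : Prop :=
  LocallyIntegrable f volume ∧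
    ∀ (x : EuclideanSpace ℝ (Fin n)) (r : ℝ), 0 < r →
      IntegrableOn (fun y => |f y| ^ p) (ball x r) volume


lemma vol_half {n : ℕ} (z x : EuclideanSpace ℝ (Fin n)) {r : ℝ} (hr : 0 < r) :
    (volume (ball z (r / 2))).toReal⁻¹ = 2 ^ n * (volume (ball x r)).toReal⁻¹ := by
  rw [Measure.addHaar_ball_of_pos volume z (half_pos hr), Measure.addHaar_ball_of_pos volume x hr]
  simp only [finrank_euclideanSpace, Fintype.card_fin, ENNReal.toReal_mul]
  rw [ENNReal.toReal_ofReal (by positivity), ENNReal.toReal_ofReal (by positivity)]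
  rw [div_pow, mul_inv, mul_inv, inv_div, div_eq_mul_inv]
  ring

lemma vol_pos {n : ℕ} (x : EuclideanSpace ℝ (Fin n)) {r : ℝ} (hr : 0 < r) :
    0 < (volume (ball x r)).toReal :=
  ENNReal.toReal_pos (measure_ball_pos volume x hr).ne' measure_ball_lt_top.ne

lemma fint {n : ℕ} {f : EuclideanSpace ℝ (Fin n) → ℝ} (hf : LocallyIntegrable f volume)
    (x : EuclideanSpace ℝ (Fin n)) (r : ℝ) : IntegrableOn f (ball x r) volume :=
  (hf.integrableOn_isCompact (isCompact_closedBall x r)).mono_set ball_subset_closedBall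

lemma jensen {n : ℕ} {p : ℝ} (hp : 1 ≤ p) {f : EuclideanSpace ℝ (Fin n) → ℝ}
    (hf : MemLpLoc p f) (x : EuclideanSpace ℝ (Fin n)) {r : ℝ} (hr : 0 < r) (c : ℝ) :
    (volume (ball x r)).toReal⁻¹ * ∫ y in ball x r, |f y - c| ≤
      ((volume (ball x r)).toReal⁻¹ * ∫ y in ball x r, |f y - c| ^ p) ^ (1 / p) := by
  have hp0 : 0 < p := by linarith
  have hfi := fint hf.1 x r
  haveI : IsFiniteMeasure (volume.restrict (ball x r)) :=
    ⟨by rw [Measure.restrict_apply_univ]; exact measure_ball_lt_top⟩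
  have hP0 : ENNReal.ofReal p ≠ 0 := by simpa using hp0
  have hpt : (ENNReal.ofReal p).toReal = p := ENNReal.toReal_ofReal hp0.le
  have h1 : MemLp f (ENNReal.ofReal p) (volume.restrict (ball x r)) := by
    rw [← integrable_norm_rpow_iff hfi.aestronglyMeasurable hP0 ENNReal.ofReal_ne_top, hpt]
    exact hf.2 x r hr
  have h2 : MemLp (fun y => f y - c) (ENNReal.ofReal p) (volume.restrict (ball x r)) :=
    h1.sub (memLp_const c)
  have h3 : Integrable (fun y => |f y - c| ^ p) (volume.restrict (ball x r)) := by
    have := (integrable_norm_rpow_iff h2.1 hP0 ENNReal.ofReal_ne_top).2 h2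
    rw [hpt] at this
    exact this
  have h4 : IntegrableOn (fun y => |f y - c|) (ball x r) volume :=
    (hfi.sub (integrable_const c)).abs
  have key := (convexOn_rpow hp).map_set_average_le (μ := volume) (t := ball x r)
    (f := fun y => |f y - c|)
    ((Real.continuous_rpow_const hp0.le).continuousOn) isClosed_Ici
    (measure_ball_pos volume x hr).ne' measure_ball_lt_top.ne
    (Eventually.of_forall fun y => Set.mem_Ici.2 (abs_nonneg _)) h4 h3
  rw [setAverage_eq, setAverage_eq] at key
  simp only [smul_eq_mul, measureReal_def] at key
  have hn : 0 ≤ (volume (ball x r)).toReal⁻¹ * ∫ y in ball x r, |f y - c| :=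
    mul_nonneg (by positivity) (integral_nonneg fun y => abs_nonneg _)
  calc _ = (((volume (ball x r)).toReal⁻¹ * ∫ y in ball x r, |f y - c|) ^ p) ^ (1 / p) := by
        rw [← Real.rpow_mul hn, mul_one_div_cancel hp0.ne', Real.rpow_one]
    _ ≤ _ := Real.rpow_le_rpow (Real.rpow_nonneg hn _) key (by positivity)

lemma osc {n : ℕ} {p α : ℝ} (hp : 1 ≤ p) {f : EuclideanSpace ℝ (Fin n) → ℝ}
    {φ : EuclideanSpace ℝ (Fin n) → ℝ → ℝ}
    (hf : MemLpLoc p f) (hS : campSemi p φ f < ⊤) (z x : EuclideanSpace ℝ (Fin n)) {r : ℝ}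
    (hr : 0 < r) (hφ : φ x r = r ^ α) (hsub : ball z (r / 2) ⊆ ball x r) :
    |ballAvg f z (r / 2) - ballAvg f x r| ≤ 2 ^ n * r ^ α * (campSemi p φ f).toReal := by
  set c := ballAvg f x r with hc
  have hV := vol_pos x hr
  have hVz := vol_pos z (half_pos hr)
  have hsemi : (φ x r)⁻¹ *
      ((volume (ball x r)).toReal⁻¹ * ∫ y in ball x r, |f y - c| ^ p) ^ (1 / p)
      ≤ (campSemi p φ f).toReal := by
    rw [← ENNReal.ofReal_le_iff_le_toReal hS.ne]
    unfold campSemi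
    exact le_iSup_of_le x (le_iSup_of_le r (le_iSup_of_le hr le_rfl))
  have hrα : 0 < r ^ α := Real.rpow_pos_of_pos hr α
  rw [hφ, inv_mul_le_iff₀ hrα] at hsemi
  have hj := (jensen hp hf x hr c).trans hsemi
  have hiz := fint hf.1 z (r / 2)
  have hix := fint hf.1 x r
  have hcz : IntegrableOn (fun _ : EuclideanSpace ℝ (Fin n) => c) (ball z (r / 2)) volume :=
    integrableOn_const measure_ball_lt_top.ne
  have hcx : IntegrableOn (fun _ : EuclideanSpace ℝ (Fin n) => c) (ball x r) volume :=
    integrableOn_const measure_ball_lt_top.ne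
  have e1 : ballAvg f z (r / 2) - c =
      (volume (ball z (r / 2))).toReal⁻¹ * ∫ y in ball z (r / 2), (f y - c) := by
    rw [integral_sub hiz hcz, setIntegral_const, smul_eq_mul, measureReal_def, mul_sub,
      inv_mul_cancel_left₀ hVz.ne']
    rfl
  rw [e1, abs_mul, abs_of_pos (inv_pos.2 hVz)]
  calc _ ≤ (volume (ball z (r / 2))).toReal⁻¹ * ∫ y in ball z (r / 2), |f y - c| := by
        gcongr
        exact abs_integral_le_integral_abs
    _ ≤ (volume (ball z (r / 2))).toReal⁻¹ * ∫ y in ball x r, |f y - c| := by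
        refine mul_le_mul_of_nonneg_left ?_ (inv_pos.2 hVz).le
        exact setIntegral_mono_set (hix.sub hcx).abs
          (Eventually.of_forall fun y => abs_nonneg _) hsub.eventuallyLE
    _ = 2 ^ n * ((volume (ball x r)).toReal⁻¹ * ∫ y in ball x r, |f y - c|) := by
        rw [vol_half z x hr, mul_assoc]
    _ ≤ 2 ^ n * (r ^ α * (campSemi p φ f).toReal) := by gcongr
    _ = _ := by ring

lemma avg_closed {n : ℕ} (f : EuclideanSpace ℝ (Fin n) → ℝ) (x : EuclideanSpace ℝ (Fin n)) {r : ℝ}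
    (hr : 0 < r) : ⨍ y in closedBall x r, f y = ballAvg f x r := by
  have h : closedBall x r =ᵐ[volume] ball x r := by
    rw [← ball_union_sphere]
    exact union_ae_eq_left_of_ae_eq_empty
      (ae_eq_empty.2 (Measure.addHaar_sphere_of_ne_zero volume x hr.ne'))
  rw [setAverage_congr h, setAverage_eq]
  rfl

/-- centre of the dyadic ball shrinking to `x` -/
def cen {n : ℕ} (x₀ x : EuclideanSpace ℝ (Fin n)) (t : ℝ) : EuclideanSpace ℝ (Fin n) :=
  x + t • (x₀ - x)

lemma ball_cen_sub {n : ℕ} {x₀ x : EuclideanSpace ℝ (Fin n)} {r₀ s t : ℝ}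
    (hx : x ∈ ball x₀ r₀) (hst : s ≤ t) :
    ball (cen x₀ x s) (s * r₀) ⊆ ball (cen x₀ x t) (t * r₀) := by
  apply ball_subset_ball'
  have : cen x₀ x s - cen x₀ x t = (t - s) • (x - x₀) := by
    unfold cen; module
  rw [dist_eq_norm, this, norm_smul, Real.norm_of_nonneg (by linarith)]
  rw [mem_ball, dist_eq_norm] at hx
  nlinarith

lemma ball_cen_sub_star {n : ℕ} {x₀ x : EuclideanSpace ℝ (Fin n)} {r₀ t : ℝ}
    (hx : x ∈ ball x₀ r₀) (ht : t ≤ 1) :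
    ball (cen x₀ x t) (t * r₀) ⊆ ball x₀ r₀ := by
  have := ball_cen_sub hx ht
  simpa [cen] using this

lemma mem_cen {n : ℕ} {x₀ x : EuclideanSpace ℝ (Fin n)} {r₀ t : ℝ}
    (hx : x ∈ ball x₀ r₀) (ht : 0 ≤ t) :
    x ∈ closedBall (cen x₀ x t) (1 * (t * r₀)) := by
  have : x - cen x₀ x t = t • (x - x₀) := by
    unfold cen; module
  rw [mem_closedBall, dist_eq_norm, this, norm_smul, Real.norm_of_nonneg ht]
  rw [mem_ball, dist_eq_norm] at hx
  nlinarith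

lemma compare {n : ℕ} {p α : ℝ} (hp : 1 ≤ p) {f : EuclideanSpace ℝ (Fin n) → ℝ}
    {φ : EuclideanSpace ℝ (Fin n) → ℝ → ℝ} {x₀ : EuclideanSpace ℝ (Fin n)} {r₀ : ℝ} (hr₀ : 0 < r₀)
    (hφ : ∀ (x : EuclideanSpace ℝ (Fin n)) (r : ℝ), 0 < r →
        ball x r ⊆ ball x₀ r₀ → φ x r = r ^ α)
    (hf : MemLpLoc p f) (hS : campSemi p φ f < ⊤) {x y : EuclideanSpace ℝ (Fin n)}
    (hx : x ∈ ball x₀ r₀) (hy : y ∈ ball x₀ r₀) {t : ℝ} (ht : 0 < t) (ht1 : t ≤ 1)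
    (hd : 2 * dist x y ≤ t * r₀) :
    |ballAvg f (cen x₀ x t) (t * r₀) - ballAvg f (cen x₀ y t) (t * r₀)| ≤
      2 * (2 ^ n * (t * r₀) ^ α * (campSemi p φ f).toReal) := by
  have hr : 0 < t * r₀ := by positivity
  have h1 := osc hp hf hS (cen x₀ y t) (cen x₀ y t) hr (hφ _ _ hr (ball_cen_sub_star hy ht1))
    (ball_subset_ball (by linarith))
  have h2 := osc hp hf hS (cen x₀ y t) (cen x₀ x t) hr (hφ _ _ hr (ball_cen_sub_star hx ht1))
    (by
      apply ball_subset_ball'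
      have : cen x₀ y t - cen x₀ x t = (1 - t) • (y - x) := by
        unfold cen; module
      rw [dist_eq_norm, this, norm_smul, Real.norm_of_nonneg (by linarith), ← dist_eq_norm,
        dist_comm]
      have := dist_nonneg (x := x) (y := y)
      nlinarith)
  rw [abs_le] at *
  constructor <;> linarith [h1.1, h1.2, h2.1, h2.2]

lemma main_bound {n : ℕ} {p α : ℝ} (hα₀ : 0 < α) (hp : 1 ≤ p) {f : EuclideanSpace ℝ (Fin n) → ℝ}
    {φ : EuclideanSpace ℝ (Fin n) → ℝ → ℝ} {x₀ : EuclideanSpace ℝ (Fin n)} {r₀ : ℝ} (hr₀ : 0 < r₀)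
    (hφ : ∀ (x : EuclideanSpace ℝ (Fin n)) (r : ℝ), 0 < r →
        ball x r ⊆ ball x₀ r₀ → φ x r = r ^ α)
    (hf : MemLpLoc p f) (hS : campSemi p φ f < ⊤) :
    ∃ g : EuclideanSpace ℝ (Fin n) → ℝ, ∀ x ∈ ball x₀ r₀,
      Tendsto (fun k : ℕ => ballAvg f (cen x₀ x ((1 / 2) ^ k)) ((1 / 2) ^ k * r₀)) atTop
        (nhds (g x)) ∧
      ∀ k : ℕ, |ballAvg f (cen x₀ x ((1 / 2) ^ k)) ((1 / 2) ^ k * r₀) - g x| ≤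
        2 ^ n * ((1 / 2) ^ k * r₀) ^ α * (campSemi p φ f).toReal / (1 - (1 / 2) ^ α) := by
  have hρ : ((1 : ℝ) / 2) ^ α < 1 := Real.rpow_lt_one (by norm_num) (by norm_num) hα₀
  have hpw : ∀ k : ℕ, (((1 : ℝ) / 2) ^ k * r₀) ^ α = r₀ ^ α * (((1 : ℝ) / 2) ^ α) ^ k := by
    intro k
    rw [Real.mul_rpow (by positivity) hr₀.le, ← Real.rpow_natCast, ← Real.rpow_natCast,
      ← Real.rpow_mul (by norm_num), ← Real.rpow_mul (by norm_num), mul_comm (k : ℝ), mul_comm]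
  refine ⟨fun x => limUnder atTop
    (fun k : ℕ => ballAvg f (cen x₀ x ((1 / 2) ^ k)) ((1 / 2) ^ k * r₀)), fun x hx => ?_⟩
  set A : ℕ → ℝ := fun k : ℕ => ballAvg f (cen x₀ x ((1 / 2) ^ k)) ((1 / 2) ^ k * r₀) with hA
  have hu : ∀ k, dist (A k) (A (k + 1)) ≤
      (2 ^ n * r₀ ^ α * (campSemi p φ f).toReal) * (((1 : ℝ) / 2) ^ α) ^ k := by
    intro k
    have hr : 0 < ((1 : ℝ) / 2) ^ k * r₀ := by positivity
    have ht1 : ((1 : ℝ) / 2) ^ k ≤ 1 := pow_le_one₀ (by norm_num) (by norm_num)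
    have e : ((1 : ℝ) / 2) ^ (k + 1) * r₀ = ((1 : ℝ) / 2) ^ k * r₀ / 2 := by rw [pow_succ]; ring
    have h := osc hp hf hS (cen x₀ x ((1 / 2) ^ (k + 1))) (cen x₀ x ((1 / 2) ^ k)) hr
      (hφ _ _ hr (ball_cen_sub_star hx ht1))
      (by
        rw [← e]
        exact ball_cen_sub hx (pow_le_pow_of_le_one (by norm_num) (by norm_num) (Nat.le_succ k)))
    rw [← e, hpw] at h
    rw [dist_comm, Real.dist_eq]
    refine h.trans (le_of_eq (by ring))
  have hlim : Tendsto A atTop (nhds (limUnder atTop A)) :=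
    (cauchySeq_of_le_geometric _ _ hρ hu).tendsto_limUnder
  refine ⟨hlim, fun k => ?_⟩
  have := dist_le_of_le_geometric_of_tendsto _ _ hρ hu hlim k
  rw [Real.dist_eq] at this
  refine this.trans (le_of_eq ?_)
  rw [hpw]
  ring

/-- If `φ(x,r) = r^α` for all balls `B(x,r) ⊆ B* = B(x₀,r₀)`, then every
`f ∈ 𝓛_{p,φ}` has a continuous representative on `B*` which is `α`-Lipschitz there, with a
constant depending only on `n` and `α`; and if `B* = B(0,1)` then moreover
`|f(0) − f_{B(0,1)}| ≤ C ‖f‖_{𝓛_{p,φ}}`. -/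
theorem campanato_locally_lipschitz (n : ℕ) (α : ℝ) (hα₀ : 0 < α) (hα₁ : α ≤ 1) :
    ∃ C > 0, ∀ (p : ℝ), 1 ≤ p →
      ∀ (φ : EuclideanSpace ℝ (Fin n) → ℝ → ℝ), GrowthPos φ →
      ∀ (x₀ : EuclideanSpace ℝ (Fin n)) (r₀ : ℝ), 0 < r₀ →
      (∀ (x : EuclideanSpace ℝ (Fin n)) (r : ℝ), 0 < r →
        ball x r ⊆ ball x₀ r₀ → φ x r = r ^ α) →
      ∀ f : EuclideanSpace ℝ (Fin n) → ℝ, MemLpLoc p f → campSemi p φ f < ⊤ →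
        ∃ g : EuclideanSpace ℝ (Fin n) → ℝ, ContinuousOn g (ball x₀ r₀) ∧
          (∀ᵐ x ∂(volume.restrict (ball x₀ r₀)), f x = g x) ∧
          (∀ x ∈ ball x₀ r₀, ∀ y ∈ ball x₀ r₀,
            ENNReal.ofReal |g x - g y| ≤
              ENNReal.ofReal (C * dist x y ^ α) * campSemi p φ f) ∧
          (x₀ = 0 → r₀ = 1 →
            ENNReal.ofReal |g 0 - ballAvg f 0 1| ≤ ENNReal.ofReal C * campSemi p φ f) := by
  have hρ : ((1 : ℝ) / 2) ^ α < 1 := Real.rpow_lt_one (by norm_num) (by norm_num) hα₀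
  have hD : 0 < 1 - ((1 : ℝ) / 2) ^ α := by linarith
  set K : ℝ := 2 * (2 ^ n + 2 ^ n / (1 - ((1 : ℝ) / 2) ^ α)) with hK
  have hKpos : 0 < K := by positivity
  have h4 : (1 : ℝ) ≤ 4 ^ α := Real.one_le_rpow (by norm_num) hα₀.le
  refine ⟨K * 4 ^ α, by positivity, ?_⟩
  intro p hp φ _ x₀ r₀ hr₀ hφ f hf hS
  obtain ⟨g, hg⟩ := main_bound hα₀ hp hr₀ hφ hf hS
  set S := (campSemi p φ f).toReal with hSdef
  have hS0 : 0 ≤ S := ENNReal.toReal_nonneg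
  have hSe : campSemi p φ f = ENNReal.ofReal S := (ENNReal.ofReal_toReal hS.ne).symm
  have hlip : ∀ x ∈ ball x₀ r₀, ∀ y ∈ ball x₀ r₀,
      |g x - g y| ≤ K * 4 ^ α * dist x y ^ α * S := by
    intro x hx y hy
    rcases eq_or_ne x y with rfl | hxy
    · simp only [sub_self, abs_zero]
      positivity
    have hd : 0 < dist x y := dist_pos.2 hxy
    obtain ⟨k, hk1, hk2⟩ : ∃ k : ℕ,
        |ballAvg f (cen x₀ x ((1 / 2) ^ k)) ((1 / 2) ^ k * r₀) -
          ballAvg f (cen x₀ y ((1 / 2) ^ k)) ((1 / 2) ^ k * r₀)| ≤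
          2 * (2 ^ n * ((1 / 2) ^ k * r₀) ^ α * S) ∧ (1 / 2) ^ k * r₀ ≤ 4 * dist x y := by
      by_cases hc : 2 * dist x y ≤ r₀
      · obtain ⟨k, h1, h2⟩ := exists_nat_pow_near_of_lt_one (x := 2 * dist x y / r₀)
          (y := (1 : ℝ) / 2) (by positivity) ((div_le_one hr₀).2 hc) (by norm_num) (by norm_num)
        rw [lt_div_iff₀ hr₀, pow_succ] at h1
        rw [div_le_iff₀ hr₀] at h2
        exact ⟨k, compare hp hr₀ hφ hf hS hx hy (by positivity)
          (pow_le_one₀ (by norm_num) (by norm_num)) h2, by linarith⟩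
      · refine ⟨0, ?_, ?_⟩
        · simp only [pow_zero, cen, one_smul, add_sub_cancel, sub_self, abs_zero]
          positivity
        · simp only [pow_zero]
          linarith
    have hx1 := (hg x hx).2 k
    have hy1 := (hg y hy).2 k
    have hpw : ((1 / 2) ^ k * r₀) ^ α ≤ 4 ^ α * dist x y ^ α := by
      rw [← Real.mul_rpow (by norm_num) hd.le]
      exact Real.rpow_le_rpow (by positivity) hk2 hα₀.le
    set T := ((1 / 2) ^ k * r₀) ^ α with hT
    calc |g x - g y| ≤ 2 * (2 ^ n * T * S) + 2 * (2 ^ n * T * S / (1 - (1 / 2) ^ α)) := by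
          rw [abs_le] at *
          constructor <;> linarith [hx1.1, hx1.2, hy1.1, hy1.2, hk1.1, hk1.2]
      _ = K * T * S := by rw [hK]; ring
      _ ≤ K * (4 ^ α * dist x y ^ α) * S := by gcongr
      _ = _ := by ring
  refine ⟨g, ?_, ?_, ?_, ?_⟩
  · intro x hx
    rw [ContinuousWithinAt, tendsto_iff_dist_tendsto_zero]
    have hz : Tendsto (fun y => K * 4 ^ α * dist y x ^ α * S) (nhdsWithin x (ball x₀ r₀))
        (nhds 0) := by
      have : ContinuousAt (fun y => K * 4 ^ α * dist y x ^ α * S) x := by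
        apply Continuous.continuousAt
        have := Real.continuous_rpow_const hα₀.le
        fun_prop
      have h := this.tendsto
      simp only [dist_self, Real.zero_rpow hα₀.ne', mul_zero, zero_mul] at h
      exact h.mono_left nhdsWithin_le_nhds
    refine squeeze_zero' (Eventually.of_forall fun y => dist_nonneg) ?_ hz
    filter_upwards [self_mem_nhdsWithin] with y hy
    exact hlip y hy x hx
  · rw [ae_restrict_iff' measurableSet_ball]
    filter_upwards [IsUnifLocDoublingMeasure.ae_tendsto_average volume hf.1 1] with x hx hxb
    have hδ : Tendsto (fun k : ℕ => ((1 : ℝ) / 2) ^ k * r₀) atTop (nhdsWithin 0 (Set.Ioi 0)) := by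
      rw [tendsto_nhdsWithin_iff]
      refine ⟨?_, Eventually.of_forall fun k => ?_⟩
      · simpa using (tendsto_pow_atTop_nhds_zero_of_lt_one (r := (1 : ℝ) / 2) (by norm_num)
          (by norm_num)).mul_const r₀
      · exact Set.mem_Ioi.2 (by positivity)
    have h1 := hx (fun k : ℕ => cen x₀ x ((1 / 2) ^ k)) _ hδ
      (Eventually.of_forall fun k => mem_cen hxb (by positivity))
    have h2 := (hg x hxb).1
    refine tendsto_nhds_unique h1 (h2.congr fun k => ?_)
    exact (avg_closed f _ (by positivity)).symm
  · intro x hx y hy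
    rw [hSe, ← ENNReal.ofReal_mul (by positivity)]
    exact ENNReal.ofReal_le_ofReal (hlip x hx y hy)
  · rintro rfl rfl
    rw [hSe, ← ENNReal.ofReal_mul (by positivity)]
    apply ENNReal.ofReal_le_ofReal
    have h := (hg 0 (mem_ball_self one_pos)).2 0
    simp only [pow_zero, cen, one_smul, add_sub_cancel, mul_one, Real.one_rpow] at h
    rw [abs_sub_comm]
    refine h.trans ?_
    calc 2 ^ n * S / (1 - (1 / 2) ^ α) = 2 ^ n / (1 - (1 / 2) ^ α) * S := by ring
      _ ≤ K * S := by
        gcongr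
        rw [hK]
        have : 0 < 2 ^ n / (1 - ((1 : ℝ) / 2) ^ α) := by positivity
        have : (0 : ℝ) < 2 ^ n := by positivity
        linarith
      _ ≤ K * 4 ^ α * S := by
        gcongr
        exact le_mul_of_one_le_right hKpos.le h4


end
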